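/- Let p > 2 be a prime, let q be a power of p, and let n be a positive integer with n ≡ 4 or 6 (mod 8) and p not dividing n. Let H be a finite perfect group whose center Z(H) has order 2 and with H/Z(H) isomorphic to the alternating group A_n (i.e. H is the double cover of A_n). Then there exists an injective group homomorphism φ : H → Sp_{2^{(n-2)/2}}(q) such that φ maps the non-identity element of Z(H) to the central involution −I of Sp_{2^{(n-2)/2}}(q). -/

import Mathlib

open scoped Pointwise in
/-- If `y` together with the family `x` satisfies the (central `z`-twisted) Carmichael relations,
adjoining `y` multiplies the order of the subgroup by at most the number of points. -/
theorem carmichael_index_step {G ι : Type*} [Group G] [Finite G]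
    (x : ι → G) (y z : G) (hz : ∀ g, z * g = g * z) (hz2 : z * z = 1)
    (hx : ∀ i, x i * x i = (x i)⁻¹) (hy : y * y = y⁻¹)
    (hxx : ∀ i j, i ≠ j → x i * x j = z * ((x j)⁻¹ * (x i)⁻¹))
    (hxy : ∀ i, x i * y = z * (y⁻¹ * (x i)⁻¹)) (hyx : ∀ i, y * x i = z * ((x i)⁻¹ * y⁻¹))
    (s : Finset ι) (K : Subgroup G) (hK : K = Subgroup.closure (insert z (x '' s))) :
    Nat.card (Subgroup.closure (insert z (insert y (x '' s)))) ≤ Nat.card K * (s.card + 3) := by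
  classical
  have hzK : z ∈ K := hK ▸ Subgroup.subset_closure (Set.mem_insert _ _)
  have hxK : ∀ i ∈ s, x i ∈ K := fun i hi ↦
    hK ▸ Subgroup.subset_closure (Set.mem_insert_of_mem _ ⟨i, hi, rfl⟩)
  let R : Finset G := insert 1 (insert y (insert y⁻¹ (s.image fun i ↦ y⁻¹ * x i)))
  have hRcard : R.card ≤ s.card + 3 := by
    refine (Finset.card_insert_le _ _).trans (Nat.succ_le_succ ?_)
    refine (Finset.card_insert_le _ _).trans (Nat.succ_le_succ ?_)
    exact (Finset.card_insert_le _ _).trans (Nat.succ_le_succ Finset.card_image_le)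
  have h1 : (1 : G) ∈ R := by simp [R]
  have hyR : y ∈ R := by simp [R]
  have hyR' : y⁻¹ ∈ R := by simp [R]
  have hyxR : ∀ i ∈ s, y⁻¹ * x i ∈ R := fun i hi ↦ by
    simp only [R, Finset.mem_insert, Finset.mem_image]
    exact Or.inr (Or.inr (Or.inr ⟨i, hi, rfl⟩))
  have hRK : ∀ r ∈ R, ∀ t ∈ insert z (insert y (x '' s)), ∃ k ∈ K, ∃ r' ∈ R, k * r' = r * t := by
    intro r hr t ht
    simp only [R, Finset.mem_insert, Finset.mem_image] at hr
    rcases ht with rfl | rfl | ⟨j, hj, rfl⟩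
    · refine ⟨t, hzK, r, ?_, hz r⟩
      simpa only [R, Finset.mem_insert, Finset.mem_image] using hr
    · rcases hr with rfl | rfl | rfl | ⟨i, hi, rfl⟩
      · exact ⟨1, K.one_mem, t, hyR, rfl⟩
      · exact ⟨1, K.one_mem, r⁻¹, hyR', by rw [hy, one_mul]⟩
      · exact ⟨1, K.one_mem, 1, h1, by simp⟩
      · refine ⟨(x i)⁻¹, K.inv_mem (hxK i hi), _, hyxR i hi, ?_⟩
        have e1 : t⁻¹ * x i * t = z * (t * (x i)⁻¹) := by
          rw [mul_assoc, hxy, ← mul_assoc, ← hz, mul_assoc, ← mul_assoc t⁻¹, ← mul_inv_rev, hy,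
            inv_inv]
        have e2 : t * (x i)⁻¹ = z * ((x i)⁻¹ * t⁻¹) * x i := by rw [← hyx, mul_assoc, hx]
        rw [e1, e2]
        simp only [← mul_assoc]
        rw [hz2, one_mul]
    · rcases hr with rfl | rfl | rfl | ⟨i, hi, rfl⟩
      · exact ⟨x j, hxK j hj, 1, h1, by simp⟩
      · exact ⟨z * (x j)⁻¹, K.mul_mem hzK (K.inv_mem (hxK j hj)), r⁻¹, hyR', by
          rw [hyx, mul_assoc]⟩
      · exact ⟨1, K.one_mem, _, hyxR j hj, one_mul _⟩
      · by_cases hij : i = j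
        · subst hij
          refine ⟨z * x i, K.mul_mem hzK (hxK i hi), y, hyR, ?_⟩
          rw [mul_assoc, hxy, ← mul_assoc, hz2, one_mul, mul_assoc, hx]
        · refine ⟨z * (x j * (x i)⁻¹), K.mul_mem hzK (K.mul_mem (hxK j hj)
            (K.inv_mem (hxK i hi))), _, hyxR i hi, ?_⟩
          have e1 : (x i)⁻¹ * y⁻¹ = z * (y * x i) := by
            rw [hyx, ← mul_assoc, hz2, one_mul]
          have e2 : x j * y = z * (y⁻¹ * (x j)⁻¹) := hxy j
          calc z * (x j * (x i)⁻¹) * (y⁻¹ * x i)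
              = z * (x j * ((x i)⁻¹ * y⁻¹)) * x i := by group
            _ = z * (x j * z) * (y * (x i * x i)) := by rw [e1]; group
            _ = (x j * y) * (x i)⁻¹ := by
                rw [← hz (x j), ← mul_assoc z z, hz2, hx]; group
            _ = y⁻¹ * (z * ((x j)⁻¹ * (x i)⁻¹)) := by
                rw [e2, hz, hz, mul_assoc, mul_assoc, mul_assoc, hz]
            _ = y⁻¹ * x i * x j := by rw [← hxx i j hij, mul_assoc]
  have hsub : (Subgroup.closure (insert z (insert y (x '' s))) : Set G) ⊆
      (K : Set G) * (R : Set G) := by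
    let M : Submonoid G :=
      { carrier := {g | ∀ r ∈ R, ∃ k ∈ K, ∃ r' ∈ R, k * r' = r * g}
        one_mem' := fun r hr ↦ ⟨1, K.one_mem, r, hr, by simp⟩
        mul_mem' := by
          intro g h hg hh r hr
          obtain ⟨k, hk, r', hr', e⟩ := hg r hr
          obtain ⟨k', hk', r'', hr'', e'⟩ := hh r' hr'
          exact ⟨k * k', K.mul_mem hk hk', r'', hr'', by
            rw [mul_assoc, e', ← mul_assoc, e, mul_assoc]⟩ }
    have hM : (Subgroup.closure (insert z (insert y (x '' s)))).toSubmonoid ≤ M := by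
      rw [Subgroup.closure_toSubmonoid_of_finite, Submonoid.closure_le]
      exact fun t ht r hr ↦ hRK r hr t ht
    intro g hg
    obtain ⟨k, hk, r', hr', e⟩ := hM hg 1 h1
    exact ⟨k, hk, r', hr', by simpa using e⟩
  calc Nat.card (Subgroup.closure (insert z (insert y (x '' s))))
      ≤ Nat.card ((K : Set G) * (R : Set G) : Set G) :=
        Nat.card_mono (Set.toFinite _) hsub
    _ ≤ Nat.card K * Nat.card (R : Set G) := Set.natCard_mul_le
    _ ≤ Nat.card K * (s.card + 3) := by
        gcongr
        simpa using hRcard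

/-- A group generated by a central `z` with `z ^ 2 = 1` and `N` elements of order dividing three
whose pairwise products square to `z` has order at most `orderOf z * (N + 2)! / 2`. -/
theorem card_closure_carmichael_le {G ι : Type*} [Group G] [Finite G]
    (x : ι → G) (z : G) (hz : ∀ g, z * g = g * z) (hz2 : z * z = 1)
    (hx : ∀ i, x i ^ 3 = 1) (hxx : ∀ i j, i ≠ j → (x i * x j) ^ 2 = z) (s : Finset ι) :
    2 * Nat.card (Subgroup.closure (insert z (x '' s))) ≤ orderOf z * (s.card + 2).factorial := by
  classical
  have hx' : ∀ i, x i * x i = (x i)⁻¹ := fun i ↦ by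
    rw [eq_inv_iff_mul_eq_one, ← pow_two, ← pow_succ, hx]
  have hxx' : ∀ i j, i ≠ j → x i * x j = z * ((x j)⁻¹ * (x i)⁻¹) := fun i j hij ↦ by
    rw [← mul_inv_rev, eq_mul_inv_iff_mul_eq, ← pow_two, hxx i j hij]
  induction s using Finset.induction_on with
  | empty =>
    have : Subgroup.closure (insert z (x '' (∅ : Finset ι))) = Subgroup.zpowers z := by
      simp [Subgroup.zpowers_eq_closure]
    rw [this, Nat.card_zpowers]
    simp [mul_comm]
  | insert a s ha ih =>
    have := carmichael_index_step (fun i : {i // i ∈ s} ↦ x i) (x a) z hz hz2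
      (fun i ↦ hx' i) (hx' a)
      (fun i j hij ↦ hxx' i j fun h ↦ hij (Subtype.ext h))
      (fun i ↦ hxx' i a fun h ↦ ha (h ▸ i.2)) (fun i ↦ hxx' a i fun h ↦ ha (h ▸ i.2))
      Finset.univ _ rfl
    have himg : (fun i : {i // i ∈ s} ↦ x i) '' (Finset.univ : Finset {i // i ∈ s}) = x '' s := by
      ext g; simp
    rw [himg] at this
    rw [Finset.coe_insert, Set.image_insert_eq, Finset.card_insert_of_notMem ha]
    have hcard : (Finset.univ : Finset {i // i ∈ s}).card = s.card := by simp
    rw [hcard] at this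
    rw [show s.card + 1 + 2 = (s.card + 2) + 1 by ring, Nat.factorial_succ]
    nlinarith

open scoped commutatorElement in
/-- A perfect group is generated modulo a central kernel only if it is generated. -/
theorem eq_top_of_map_eq_top_of_ker_le_center {H A : Type*} [Group H] [Group A]
    (hperf : commutator H = ⊤) (π : H →* A) (hπ : π.ker ≤ Subgroup.center H)
    (K : Subgroup H) (hK : K.map π = π.range) : K = ⊤ := by
  have key : ∀ h : H, ∃ k ∈ K, ∃ c ∈ Subgroup.center H, h = k * c := by
    intro h
    obtain ⟨k, hk, e⟩ : π h ∈ K.map π := hK ▸ ⟨h, rfl⟩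
    exact ⟨k, hk, k⁻¹ * h, hπ (by rw [MonoidHom.mem_ker, map_mul, map_inv, e, inv_mul_cancel]),
      by simp⟩
  rw [eq_top_iff, ← hperf, commutator_def, Subgroup.commutator_le]
  intro g _ h _
  obtain ⟨k, hk, c, hc, rfl⟩ := key g
  obtain ⟨l, hl, d, hd, rfl⟩ := key h
  rw [Subgroup.mem_center_iff] at hc hd
  have : ⁅k * c, l * d⁆ = ⁅k, l⁆ := by
    rw [commutatorElement_def, commutatorElement_def, mul_inv_rev, mul_inv_rev]
    calc k * c * (l * d) * (c⁻¹ * k⁻¹) * (d⁻¹ * l⁻¹)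
        = k * (c * (l * d)) * c⁻¹ * k⁻¹ * d⁻¹ * l⁻¹ := by group
      _ = k * l * (d * k⁻¹) * d⁻¹ * l⁻¹ := by rw [← hc (l * d)]; group
      _ = k * l * k⁻¹ * l⁻¹ := by rw [← hd k⁻¹]; group
  rw [this]
  exact K.mul_mem (K.mul_mem (K.mul_mem hk hl) (K.inv_mem hk)) (K.inv_mem hl)

open Equiv in
/-- The three-cycles through two fixed points `a`, `b` generate the alternating group. -/
theorem Equiv.Perm.alternatingGroup_le_of_swap_mul_swap_mem {α : Type*} [Fintype α] [DecidableEq α]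
    {a b : α} (hab : a ≠ b) (P : Subgroup (Perm α)) (hP : P ≤ alternatingGroup α)
    (h : ∀ i, i ≠ a → i ≠ b → swap a b * swap a i ∈ P) : alternatingGroup α ≤ P := by
  have hstar : ∀ i g, (g ∈ P ∨ swap a b * g ∈ P) →
      (swap a i * g ∈ P ∨ swap a b * (swap a i * g) ∈ P) := by
    intro i g hg
    by_cases hia : i = a
    · subst hia; simpa [← Perm.one_def] using hg
    by_cases hib : i = b
    · subst hib
      rw [swap_mul_self_mul]
      exact hg.symm
    rcases hg with hg | hg
    · right
      rw [← mul_assoc]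
      exact P.mul_mem (h i hia hib) hg
    · left
      have := P.mul_mem (P.inv_mem (h i hia hib)) hg
      rwa [mul_inv_rev, swap_inv, swap_inv, mul_assoc, swap_mul_self_mul] at this
  have hall : ∀ g : Perm α, g ∈ P ∨ swap a b * g ∈ P := by
    intro g
    induction g using swap_induction_on with
    | one => exact Or.inl P.one_mem
    | swap_mul f u v huv ih =>
      by_cases hu : u = a
      · subst hu; exact hstar v f ih
      by_cases hv : v = a
      · subst hv; rw [swap_comm]; exact hstar u f ih
      · have e : swap u v = swap a u * swap a v * swap a u := by
          rw [swap_comm a u, swap_comm a v, swap_comm u a, ← swap_mul_swap_mul_swap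
            (x := v) (y := a) (z := u) hv (Ne.symm huv)]
        rw [e, mul_assoc, mul_assoc]
        exact hstar u _ (hstar v _ (hstar u _ ih))
  intro g hg
  refine (hall g).resolve_right fun hg' ↦ ?_
  have := hP hg'
  rw [mem_alternatingGroup] at this hg
  rw [map_mul, hg, sign_swap hab] at this
  exact absurd this (by decide)

open Equiv in
/-- The three-cycle through `a`, `b` and `i`, as an element of the alternating group. -/
def carmichaelCycle {α : Type*} [Fintype α] [DecidableEq α] {a b : α} (hab : a ≠ b)
    (i : {i // i ≠ a ∧ i ≠ b}) : alternatingGroup α :=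
  ⟨swap a b * swap a i,
    (Perm.isThreeCycle_swap_mul_swap_same hab (Ne.symm i.2.1) (Ne.symm i.2.2)).mem_alternatingGroup⟩

section CarmichaelCycle

open Equiv

variable {α : Type*} [Fintype α] [DecidableEq α] {a b : α}

theorem carmichaelCycle_pow_three (hab : a ≠ b) (i : {i // i ≠ a ∧ i ≠ b}) :
    carmichaelCycle hab i ^ 3 = 1 := by
  apply Subtype.ext
  have h := Perm.isThreeCycle_swap_mul_swap_same hab (Ne.symm i.2.1) (Ne.symm i.2.2)
  have := pow_orderOf_eq_one (swap a b * swap a (i : α))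
  rwa [h.orderOf] at this

theorem carmichaelCycle_mul_pow_two (hab : a ≠ b) {i j : {i // i ≠ a ∧ i ≠ b}} (hij : i ≠ j) :
    (carmichaelCycle hab i * carmichaelCycle hab j) ^ 2 = 1 := by
  apply Subtype.ext
  change (swap a b * swap a (i : α) * (swap a b * swap a (j : α))) ^ 2 = 1
  obtain ⟨i, hia, hib⟩ := i
  obtain ⟨j, hja, hjb⟩ := j
  have hij' : i ≠ j := fun h ↦ hij (Subtype.ext h)
  have e : swap a b * swap a i * swap a b = swap b i := by
    rw [swap_comm a i, swap_mul_swap_mul_swap hia hib, swap_comm b i]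
  rw [← mul_assoc, e]
  have hd : Perm.Disjoint (swap b i) (swap a j) := by
    rw [Perm.disjoint_iff_disjoint_support, Perm.support_swap (Ne.symm hib),
      Perm.support_swap (Ne.symm hja)]
    simp [hab, hjb, Ne.symm hij', Ne.symm hia]
  rw [hd.commute.mul_pow, pow_two, pow_two, swap_mul_self, swap_mul_self, one_mul]

theorem closure_range_carmichaelCycle (hab : a ≠ b) :
    Subgroup.closure (Set.range (carmichaelCycle hab)) = ⊤ := by
  set P := (Subgroup.closure (Set.range (carmichaelCycle hab))).map
    (alternatingGroup α).subtype with hPdef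
  have hP : P ≤ alternatingGroup α := by
    rintro _ ⟨g, -, rfl⟩
    exact g.2
  have hle := Perm.alternatingGroup_le_of_swap_mul_swap_mem hab P hP fun i hia hib ↦
    ⟨carmichaelCycle hab ⟨i, hia, hib⟩, Subgroup.subset_closure ⟨_, rfl⟩, rfl⟩
  rw [eq_top_iff]
  intro g _
  obtain ⟨g', hg', e⟩ := hle g.2
  rwa [← Subtype.ext (show (g' : Perm α) = g from e)]

theorem exists_conj_carmichaelCycle (hab : a ≠ b) (hα : 6 ≤ Fintype.card α)
    {i j k l : {i // i ≠ a ∧ i ≠ b}}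
    (hij : i ≠ j) (hkl : k ≠ l) : ∃ σ : alternatingGroup α,
      σ * carmichaelCycle hab i * σ⁻¹ = carmichaelCycle hab k ∧
      σ * carmichaelCycle hab j * σ⁻¹ = carmichaelCycle hab l := by
  have hemb : ∀ u v : {i // i ≠ a ∧ i ≠ b}, u ≠ v →
      Function.Injective ![a, b, (u : α), (v : α)] := by
    rintro ⟨u, hu⟩ ⟨v, hv⟩ huv
    have huv' : u ≠ v := fun h ↦ huv (Subtype.ext h)
    intro s t
    fin_cases s <;> fin_cases t <;>
      simp [hab, Ne.symm hab, hu.1, hu.2, hv.1, hv.2, huv', Ne.symm huv', Ne.symm hu.1,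
        Ne.symm hu.2, Ne.symm hv.1, Ne.symm hv.2]
  have h1 := alternatingGroup.isMultiplyPretransitive α
  have hcard : Nat.card α = Fintype.card α := Nat.card_eq_fintype_card
  have h4 : MulAction.IsMultiplyPretransitive (alternatingGroup α) α 4 :=
    MulAction.isMultiplyPretransitive_of_le (n := Nat.card α - 2) (by omega) (by omega)
  rw [MulAction.isMultiplyPretransitive_iff] at h4
  obtain ⟨σ, hσ⟩ := h4 ⟨_, hemb i j hij⟩ ⟨_, hemb k l hkl⟩
  have hσ' : ∀ t, σ.1 (![a, b, (i : α), (j : α)] t) = ![a, b, (k : α), (l : α)] t :=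
    fun t ↦ DFunLike.congr_fun hσ t
  have ha : σ.1 a = a := hσ' 0
  have hb : σ.1 b = b := hσ' 1
  have hi : σ.1 i = k := hσ' 2
  have hj : σ.1 j = l := hσ' 3
  have conj : ∀ u v : {i // i ≠ a ∧ i ≠ b}, σ.1 u = v →
      σ * carmichaelCycle hab u * σ⁻¹ = carmichaelCycle hab v := by
    intro u v huv
    apply Subtype.ext
    change σ.1 * (swap a b * swap a (u : α)) * σ.1⁻¹ = swap a b * swap a (v : α)
    have e : σ.1 * (swap a b * swap a (u : α)) * σ.1⁻¹ =
        (σ.1 * swap a b * σ.1⁻¹) * (σ.1 * swap a (u : α) * σ.1⁻¹) := by group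
    rw [e, ← swap_apply_apply, ← swap_apply_apply, ha, hb, huv]
  exact ⟨σ, conj i k hi, conj j l hj⟩

theorem card_compl_pair_add_two (hab : a ≠ b) :
    Fintype.card {i // i ≠ a ∧ i ≠ b} + 2 = Fintype.card α := by
  have h : ({a, b} : Finset α).card = 2 := Finset.card_pair hab
  rw [Fintype.card_subtype, ← h, ← Finset.card_compl_add_card {a, b}]
  congr 2
  ext i
  simp

variable {H : Type*} [Group H]

theorem card_eq_factorial_of_double_cover [Nontrivial α] (π : H →* alternatingGroup α)
    (hπ : Function.Surjective π) (hker : Nat.card π.ker = 2) :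
    Nat.card H = (Fintype.card α).factorial := by
  rw [Subgroup.card_eq_card_quotient_mul_card_subgroup π.ker, hker,
    Nat.card_congr (QuotientGroup.quotientKerEquivOfSurjective π hπ).toEquiv, mul_comm,
    two_mul_nat_card_alternatingGroup, Nat.card_perm, Nat.card_eq_fintype_card]

/-- A perfect double cover of the alternating group is generated by lifts of order three of the
three-cycles through `a` and `b`, and pairwise products of these square to the central
involution. -/
theorem exists_carmichael_lift [Finite H] (hab : a ≠ b) (hα : 6 ≤ Fintype.card α)
    (hperf : commutator H = ⊤)
    (π : H →* alternatingGroup α) (hπ : Function.Surjective π) (hker : π.ker = Subgroup.center H)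
    {z : H} (hz : z ∈ Subgroup.center H) (hz1 : z ≠ 1) (hz2 : z * z = 1)
    (hcenter : ∀ c ∈ Subgroup.center H, c = 1 ∨ c = z)
    (hcard : Nat.card H = (Fintype.card α).factorial) :
    ∃ X : {i // i ≠ a ∧ i ≠ b} → H, (∀ i, X i ^ 3 = 1) ∧
      (∀ i j, i ≠ j → (X i * X j) ^ 2 = z) ∧ Subgroup.closure (Set.range X) = ⊤ := by
  have hzc : ∀ g, z * g = g * z := fun g ↦ (Subgroup.mem_center_iff.mp hz g).symm
  have hkz : ∀ h, π h = 1 → h = 1 ∨ h = z := fun h hh ↦ hcenter h (hker ▸ hh)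
  have hπz : π z = 1 := by rw [← MonoidHom.mem_ker, hker]; exact hz
  have hlift : ∀ i : {i // i ≠ a ∧ i ≠ b}, ∃ x : H, π x = carmichaelCycle hab i ∧ x ^ 3 = 1 := by
    intro i
    obtain ⟨x, hx⟩ := hπ (carmichaelCycle hab i)
    rcases hkz (x ^ 3) (by rw [map_pow, hx, carmichaelCycle_pow_three]) with h | h
    · exact ⟨x, hx, h⟩
    · refine ⟨z * x, by rw [map_mul, hπz, one_mul, hx], ?_⟩
      rw [Commute.mul_pow (hzc x), h, pow_succ, pow_two, hz2, one_mul, hz2]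
  choose X hX hX3 using hlift
  have huniq : ∀ x y : H, π x = π y → x ^ 3 = 1 → y ^ 3 = 1 → x = y := by
    intro x y hxy hx hy
    rcases hkz (x * y⁻¹) (by rw [map_mul, map_inv, hxy, mul_inv_cancel]) with h | h
    · exact mul_inv_eq_one.mp h
    · rw [mul_inv_eq_iff_eq_mul] at h
      rw [h, Commute.mul_pow (hzc y), hy, mul_one, pow_succ, pow_two, hz2, one_mul] at hx
      exact absurd hx hz1
  have htop : Subgroup.closure (Set.range X) = ⊤ := by
    apply eq_top_of_map_eq_top_of_ker_le_center hperf π hker.le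
    rw [MonoidHom.map_closure, ← Set.range_comp, MonoidHom.range_eq_top.mpr hπ,
      ← closure_range_carmichaelCycle hab]
    congr 1
    exact congrArg Set.range (funext hX)
  have hconj : ∀ i j k l, i ≠ j → k ≠ l → (X i * X j) ^ 2 = (X k * X l) ^ 2 := by
    intro i j k l hij hkl
    obtain ⟨σ, h1, h2⟩ := exists_conj_carmichaelCycle hab hα hij hkl
    obtain ⟨g, rfl⟩ := hπ σ
    have hg : ∀ u v, π g * carmichaelCycle hab u * (π g)⁻¹ = carmichaelCycle hab v →
        g * X u * g⁻¹ = X v := fun u v huv ↦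
      huniq _ _ (by simp only [map_mul, map_inv, hX, huv]) (by rw [conj_pow, hX3]; simp) (hX3 v)
    have hc : (X i * X j) ^ 2 ∈ Subgroup.center H := by
      rw [← hker, MonoidHom.mem_ker, map_pow, map_mul, hX, hX, carmichaelCycle_mul_pow_two hab hij]
    rw [← hg i k h1, ← hg j l h2,
      show g * X i * g⁻¹ * (g * X j * g⁻¹) = g * (X i * X j) * g⁻¹ by group, conj_pow,
      Subgroup.mem_center_iff.mp hc g, mul_inv_cancel_right]
  refine ⟨X, hX3, ?_, htop⟩
  intro i j hij
  have hc : π ((X i * X j) ^ 2) = 1 := by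
    rw [map_pow, map_mul, hX, hX, carmichaelCycle_mul_pow_two hab hij]
  refine (hkz _ hc).resolve_left fun h1 ↦ ?_
  have hle := card_closure_carmichael_le X (1 : H) (by simp) (by simp) hX3
    (fun k l hkl ↦ (hconj k l i j hkl hij).trans h1) Finset.univ
  have htop' :
      Subgroup.closure (insert 1 (X '' (Finset.univ : Finset {i // i ≠ a ∧ i ≠ b}))) = ⊤ := by
    rw [Subgroup.closure_insert_one, Finset.coe_univ, Set.image_univ, htop]
  rw [htop', Subgroup.card_top, hcard, orderOf_one, one_mul, Finset.card_univ,
    card_compl_pair_add_two hab] at hle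
  have := Nat.factorial_pos (Fintype.card α)
  omega

/-- The double cover of the alternating group maps to any group containing elements of order three
whose pairwise products square to a given central involution. -/
theorem exists_hom_of_carmichael_relations [Finite H] (hab : a ≠ b) {S : Type*} [Group S]
    [Finite S]
    {z : H} (hzc : ∀ g, z * g = g * z) (hz2 : z * z = 1)
    (hcard : Nat.card H = (Fintype.card α).factorial)
    (X : {i // i ≠ a ∧ i ≠ b} → H) (hX3 : ∀ i, X i ^ 3 = 1)
    (hXX : ∀ i j, i ≠ j → (X i * X j) ^ 2 = z) (hX : Subgroup.closure (Set.range X) = ⊤)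
    {w : S} (hwc : ∀ g, w * g = g * w) (hw2 : w * w = 1)
    (T : {i // i ≠ a ∧ i ≠ b} → S) (hT3 : ∀ i, T i ^ 3 = 1)
    (hTT : ∀ i j, i ≠ j → (T i * T j) ^ 2 = w) :
    ∃ φ : H →* S, φ z = w := by
  have hle := card_closure_carmichael_le (fun i ↦ (X i, T i)) (z, w)
    (fun g ↦ Prod.ext (hzc g.1) (hwc g.2)) (Prod.ext hz2 hw2)
    (fun i ↦ Prod.ext (hX3 i) (hT3 i)) (fun i j hij ↦ Prod.ext (hXX i j hij) (hTT i j hij))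
    Finset.univ
  rw [Finset.coe_univ, Set.image_univ, Finset.card_univ, card_compl_pair_add_two hab,
    ← hcard] at hle
  set L := Subgroup.closure (insert (z, w) (Set.range fun i ↦ (X i, T i))) with hL
  have hzw : (z, w) ∈ L := Subgroup.subset_closure (Set.mem_insert _ _)
  have hord : orderOf (z, w) ≤ 2 :=
    orderOf_le_of_pow_eq_one (n := 2) two_pos (by rw [pow_two]; exact Prod.ext hz2 hw2)
  have hLcard : Nat.card L ≤ Nat.card H := by nlinarith
  let f : L →* H := (MonoidHom.fst H S).comp L.subtype
  have hsurj : Function.Surjective f := by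
    rw [← MonoidHom.range_eq_top, eq_top_iff, ← hX, Subgroup.closure_le]
    rintro _ ⟨i, rfl⟩
    exact ⟨⟨(X i, T i), Subgroup.subset_closure (Set.mem_insert_of_mem _ ⟨i, rfl⟩)⟩, rfl⟩
  have hbij : Function.Bijective f :=
    (Nat.bijective_iff_surjective_and_card f).mpr
      ⟨hsurj, le_antisymm hLcard (Nat.card_le_card_of_surjective f hsurj)⟩
  let e : L ≃* H := MulEquiv.ofBijective f hbij
  refine ⟨((MonoidHom.snd H S).comp L.subtype).comp e.symm.toMonoidHom, ?_⟩
  have : e.symm z = ⟨(z, w), hzw⟩ := by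
    rw [MulEquiv.symm_apply_eq]
    rfl
  simp [this]

end CarmichaelCycle

/-- A homomorphism from a perfect double cover of a simple group that does not kill the central
involution is injective. -/
theorem injective_of_perfect_double_cover {H A S : Type*} [Group H] [Group A] [IsSimpleGroup A]
    [Group S] (hperf : commutator H = ⊤) (π : H →* A) (hπ : Function.Surjective π)
    (hker : π.ker = Subgroup.center H) {z : H}
    (hcenter : ∀ c ∈ Subgroup.center H, c = 1 ∨ c = z)
    (φ : H →* S) (hφ : φ z ≠ 1) : Function.Injective φ := by
  rw [← MonoidHom.ker_eq_bot_iff]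
  have hn : (φ.ker.map π).Normal := Subgroup.Normal.map inferInstance π hπ
  rcases hn.eq_bot_or_eq_top with h | h
  · rw [Subgroup.map_eq_bot_iff, hker] at h
    rw [eq_bot_iff]
    intro g hg
    rcases hcenter g (h hg) with rfl | rfl
    · exact Subgroup.mem_bot.mpr rfl
    · exact absurd hg hφ
  · have := eq_top_of_map_eq_top_of_ker_le_center hperf π hker.le φ.ker
      (by rw [h, MonoidHom.range_eq_top.mpr hπ])
    have hz : z ∈ φ.ker := this ▸ Subgroup.mem_top z
    exact absurd hz hφ

/-- The alternating group on four letters is not a quotient of a perfect group. -/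
theorem not_perfect_of_surjective_alternatingGroup_four {α H : Type*} [Fintype α] [DecidableEq α]
    (hα : Nat.card α = 4) [Group H] (π : H →* alternatingGroup α) (hπ : Function.Surjective π) :
    commutator H ≠ ⊤ := by
  intro hperf
  have h : commutator (alternatingGroup α) = ⊤ := by
    have : (commutator H).map π = commutator (alternatingGroup α) := by
      rw [commutator_def, commutator_def, Subgroup.map_commutator,
        Subgroup.map_top_of_surjective π hπ]
    rw [← this, hperf, Subgroup.map_top_of_surjective π hπ]
  rw [← alternatingGroup.kleinFour_eq_commutator hα] at h
  have h4 := alternatingGroup.kleinFour_card_of_card_eq_four hα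
  rw [h, Subgroup.card_top, alternatingGroup.card_of_card_eq_four hα] at h4
  omega

section CliffordModels

open Matrix Kronecker

theorem Matrix.neg_kronecker {R ι κ ι' κ' : Type*} [CommRing R] (A : Matrix ι κ R)
    (B : Matrix ι' κ' R) : (-A) ⊗ₖ B = -(A ⊗ₖ B) := by
  ext; simp

theorem Matrix.kronecker_neg {R ι κ ι' κ' : Type*} [CommRing R] (A : Matrix ι κ R)
    (B : Matrix ι' κ' R) : A ⊗ₖ (-B) = -(A ⊗ₖ B) := by
  ext; simp

/-- Pairwise anticommuting matrices `x i` with `x i ^ 2 = d i`, together with an invertible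
`ε`-symmetric form `K` with respect to which the adjoint of `x i` is `δ • x i`. -/
structure IsCliffordModel {F κ ι : Type*} [Field F] [Fintype ι] [DecidableEq ι] (δ ε : F)
    (d : κ → F) (x : κ → Matrix ι ι F) (K : Matrix ι ι F) : Prop where
  sq : ∀ i, x i * x i = d i • (1 : Matrix ι ι F)
  anticomm : ∀ i j, i ≠ j → x i * x j = -(x j * x i)
  isUnit : IsUnit K
  symm : Kᵀ = ε • K
  adj : ∀ i, x i * K = δ • (K * (x i)ᵀ)

namespace IsCliffordModel

variable {F κ ι ι' : Type*} [Field F] [Fintype ι] [DecidableEq ι] [Fintype ι'] [DecidableEq ι']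

theorem empty [IsEmpty κ] (δ : F) (d : κ → F) :
    IsCliffordModel δ 1 d (fun _ ↦ (1 : Matrix Unit Unit F)) 1 where
  sq i := isEmptyElim i
  anticomm i := isEmptyElim i
  isUnit := isUnit_one
  symm := by simp
  adj i := isEmptyElim i

theorem tensor {γ ε ε' α β : F} {X Y K : Matrix ι ι F} {m : ℕ} {d : Fin m → F}
    {x : Fin m → Matrix ι' ι' F} {K' : Matrix ι' ι' F} (hγ : γ * γ = 1)
    (h : IsCliffordModel γ ε ![α, β] ![X, Y] K) (h' : IsCliffordModel (-γ) ε' d x K') :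
    IsCliffordModel γ (ε * ε') (Fin.cons α (Fin.cons β fun i ↦ -(α * β) * d i) : Fin (m + 2) → F)
      (Fin.cons (X ⊗ₖ 1) (Fin.cons (Y ⊗ₖ 1) fun i ↦ (X * Y) ⊗ₖ x i)) (K ⊗ₖ K') := by
  have hX : X * X = α • (1 : Matrix ι ι F) := h.sq 0
  have hY : Y * Y = β • (1 : Matrix ι ι F) := h.sq 1
  have hXY : X * Y = -(Y * X) := h.anticomm 0 1 (by decide)
  have hXK : X * K = γ • (K * Xᵀ) := h.adj 0
  have hYK : Y * K = γ • (K * Yᵀ) := h.adj 1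
  have hYX : Y * X = -(X * Y) := by rw [hXY, neg_neg]
  have hXYXY : X * Y * (X * Y) = (-(α * β)) • (1 : Matrix ι ι F) := by
    rw [Matrix.mul_assoc, ← Matrix.mul_assoc Y, hYX, Matrix.neg_mul, Matrix.mul_assoc, hY]
    simp only [Matrix.mul_smul, Matrix.mul_neg, Matrix.mul_one, hX, smul_smul, neg_smul]
    rw [mul_comm β]
  have hX1 : X * (X * Y) = -(X * Y * X) := by
    rw [Matrix.mul_assoc X Y, hYX, Matrix.mul_neg, neg_neg]
  have hY1 : Y * (X * Y) = -(X * Y * Y) := by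
    rw [← Matrix.mul_assoc, hYX, Matrix.neg_mul]
  have hXYK : X * Y * K = -(K * (X * Y)ᵀ) := by
    rw [Matrix.mul_assoc, hYK, Matrix.mul_smul, ← Matrix.mul_assoc, hXK, Matrix.smul_mul, smul_smul,
      hγ, one_smul, Matrix.mul_assoc, ← transpose_mul, hYX, transpose_neg, Matrix.mul_neg]
  refine ⟨?_, ?_, ?_, ?_, ?_⟩
  · simp only [Fin.forall_fin_succ, Fin.cons_zero, Fin.cons_succ]
    refine ⟨?_, ?_, fun i ↦ ?_⟩
    · rw [← mul_kronecker_mul, hX, smul_kronecker, Matrix.one_mul, one_kronecker_one]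
    · rw [← mul_kronecker_mul, hY, smul_kronecker, Matrix.one_mul, one_kronecker_one]
    · rw [← mul_kronecker_mul, hXYXY, h'.sq, smul_kronecker, kronecker_smul, one_kronecker_one,
        smul_smul]
  · simp only [Fin.forall_fin_succ, Fin.cons_zero, Fin.cons_succ, ← mul_kronecker_mul,
      Matrix.one_mul, Matrix.mul_one]
    refine ⟨⟨by simp, fun _ ↦ ?_, fun i _ ↦ ?_⟩, ⟨fun _ ↦ ?_, by simp, fun i _ ↦ ?_⟩,
      fun i ↦ ⟨fun _ ↦ ?_, fun _ ↦ ?_, fun j hij ↦ ?_⟩⟩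
    · rw [hXY, neg_kronecker]
    · rw [hX1, neg_kronecker]
    · rw [hYX, neg_kronecker]
    · rw [hY1, neg_kronecker]
    · rw [hX1, neg_kronecker, neg_neg]
    · rw [hY1, neg_kronecker, neg_neg]
    · rw [h'.anticomm i j fun e ↦ hij (by rw [e]), kronecker_neg]
  · obtain ⟨u, hu⟩ := h.isUnit
    obtain ⟨v, hv⟩ := h'.isUnit
    refine IsUnit.of_mul_eq_one ((↑u⁻¹ : Matrix ι ι F) ⊗ₖ (↑v⁻¹ : Matrix ι' ι' F)) ?_
    rw [← mul_kronecker_mul, ← hu, ← hv, Units.mul_inv, Units.mul_inv, one_kronecker_one]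
  · rw [← kroneckerMap_transpose, h.symm, h'.symm, smul_kronecker, kronecker_smul, smul_smul]
  · simp only [Fin.forall_fin_succ, Fin.cons_zero, Fin.cons_succ, ← mul_kronecker_mul,
      ← kroneckerMap_transpose, transpose_one, Matrix.one_mul, Matrix.mul_one]
    refine ⟨?_, ?_, fun i ↦ ?_⟩
    · rw [hXK, smul_kronecker]
    · rw [hYK, smul_kronecker]
    · rw [hXYK, h'.adj, neg_kronecker, kronecker_smul, neg_smul, neg_neg]

theorem conj {δ ε : F} {d : κ → F} {x : κ → Matrix ι ι F} {K : Matrix ι ι F}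
    (h : IsCliffordModel δ ε d x K) {P : Matrix ι' ι F} {Q : Matrix ι ι' F} (hPQ : P * Q = 1)
    (hQP : Q * P = 1) :
    IsCliffordModel δ ε d (fun i ↦ P * x i * Q) (P * K * Pᵀ) := by
  have hQPt : Pᵀ * Qᵀ = 1 := by rw [← transpose_mul, hQP, transpose_one]
  have hPQt : Qᵀ * Pᵀ = 1 := by rw [← transpose_mul, hPQ, transpose_one]
  have hmul : ∀ A B : Matrix ι ι F, P * A * Q * (P * B * Q) = P * (A * B) * Q := fun A B ↦ by
    calc P * A * Q * (P * B * Q) = P * A * (Q * P) * (B * Q) := by simp only [Matrix.mul_assoc]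
      _ = _ := by rw [hQP]; simp only [Matrix.mul_assoc, Matrix.one_mul]
  refine ⟨fun i ↦ ?_, fun i j hij ↦ ?_, ?_, ?_, fun i ↦ ?_⟩
  · rw [hmul, h.sq, Matrix.mul_smul, Matrix.mul_one, Matrix.smul_mul, hPQ]
  · rw [hmul, hmul, h.anticomm i j hij, Matrix.mul_neg, Matrix.neg_mul]
  · obtain ⟨u, hu⟩ := h.isUnit
    refine IsUnit.of_mul_eq_one (Qᵀ * (↑u⁻¹ : Matrix ι ι F) * Q) ?_
    calc P * K * Pᵀ * (Qᵀ * (↑u⁻¹ : Matrix ι ι F) * Q)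
        = P * (K * (Pᵀ * Qᵀ) * (↑u⁻¹ : Matrix ι ι F)) * Q := by simp only [Matrix.mul_assoc]
      _ = 1 := by rw [hQPt, Matrix.mul_one, ← hu, Units.mul_inv, Matrix.mul_one, hPQ]
  · rw [transpose_mul, transpose_mul, transpose_transpose, h.symm, Matrix.smul_mul, Matrix.mul_smul,
      Matrix.mul_assoc]
  · calc P * x i * Q * (P * K * Pᵀ) = P * x i * (Q * P) * (K * Pᵀ) := by
          simp only [Matrix.mul_assoc]
      _ = P * (x i * K) * Pᵀ := by rw [hQP]; simp only [Matrix.mul_assoc, Matrix.one_mul]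
      _ = δ • (P * K * (Pᵀ * Qᵀ) * (x i)ᵀ * Pᵀ) := by
          rw [h.adj, hQPt]
          simp only [Matrix.mul_assoc, Matrix.one_mul, Matrix.mul_smul, Matrix.smul_mul]
      _ = δ • (P * K * Pᵀ * (P * x i * Q)ᵀ) := by
          rw [transpose_mul, transpose_mul]
          simp only [Matrix.mul_assoc]

theorem submatrix {δ ε : F} {d : κ → F} {x : κ → Matrix ι ι F} {K : Matrix ι ι F}
    (h : IsCliffordModel δ ε d x K) (e : ι' ≃ ι) :
    IsCliffordModel δ ε d (fun i ↦ (x i).submatrix e e) (K.submatrix e e) where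
  sq i := by
    rw [submatrix_mul_equiv, h.sq]
    simp [submatrix_smul]
  anticomm i j hij := by
    rw [submatrix_mul_equiv, submatrix_mul_equiv, h.anticomm i j hij]
    rfl
  isUnit := by rw [isUnit_submatrix_equiv]; exact h.isUnit
  symm := by
    rw [transpose_submatrix, h.symm]
    rfl
  adj i := by
    rw [transpose_submatrix, submatrix_mul_equiv, submatrix_mul_equiv, h.adj]
    rfl

theorem exists_neg_plane [Finite F] (h2 : (2 : F) ≠ 0) {α : F} (hα : α ≠ 0) (β : F) :
    ∃ X Y : Matrix (Fin 2) (Fin 2) F,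
      IsCliffordModel (-1 : F) (-1) ![α, β] ![X, Y] !![0, -1; 1, 0] := by
  have := Fintype.ofFinite F
  have hodd : Fintype.card F % 2 = 1 := by
    refine FiniteField.odd_card_of_char_ne_two fun h ↦ h2 ?_
    have := CharP.cast_eq_zero F (ringChar F)
    rw [h] at this
    exact_mod_cast this
  obtain ⟨a, c, hac⟩ := FiniteField.exists_root_sum_quadratic
    (f := Polynomial.X ^ 2 - Polynomial.C β) (g := Polynomial.C (-α) * Polynomial.X ^ 2)
    (Polynomial.degree_X_pow_sub_C two_pos β)
    (Polynomial.degree_C_mul_X_pow 2 (neg_ne_zero.mpr hα)) hodd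
  simp only [Polynomial.eval_sub, Polynomial.eval_pow, Polynomial.eval_X, Polynomial.eval_C,
    Polynomial.eval_mul] at hac
  have hβ : β = a ^ 2 - α * c ^ 2 := by linear_combination -hac
  refine ⟨!![0, α; 1, 0], !![a, -(α * c); c, -a], ?_, ?_, ?_, ?_, ?_⟩
  · simp only [Fin.forall_fin_two]
    constructor <;> ext i j <;> fin_cases i <;> fin_cases j <;>
      simp [Matrix.mul_apply, Fin.sum_univ_two, hβ] <;> ring
  · simp only [Fin.forall_fin_two]
    refine ⟨⟨by simp, fun _ ↦ ?_⟩, ⟨fun _ ↦ ?_, by simp⟩⟩ <;>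
      ext i j <;> fin_cases i <;> fin_cases j <;>
      simp [Matrix.mul_apply, Fin.sum_univ_two] <;> ring
  · rw [isUnit_iff_isUnit_det]
    simp [det_fin_two]
  · ext i j; fin_cases i <;> fin_cases j <;> simp
  · simp only [Fin.forall_fin_two]
    constructor <;> ext i j <;> fin_cases i <;> fin_cases j <;>
      simp [vecMul, dotProduct, Fin.sum_univ_two]

theorem exists_plane [Finite F] (h2 : (2 : F) ≠ 0) {γ : F} (hγ : γ = 1 ∨ γ = -1) {α β : F}
    (hα : α ≠ 0) (hβ : β ≠ 0) :
    ∃ X Y K : Matrix (Fin 2) (Fin 2) F, IsCliffordModel γ γ ![α, β] ![X, Y] K := by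
  obtain ⟨X, Y, h⟩ := exists_neg_plane h2 hα β
  set ω : Matrix (Fin 2) (Fin 2) F := !![0, -1; 1, 0]
  rcases hγ with rfl | rfl
  · have hX : X * X = α • (1 : Matrix (Fin 2) (Fin 2) F) := h.sq 0
    have hY : Y * Y = β • (1 : Matrix (Fin 2) (Fin 2) F) := h.sq 1
    have hXY : X * Y = -(Y * X) := h.anticomm 0 1 (by decide)
    have hXω : X * ω = -(ω * Xᵀ) := by simpa using h.adj 0
    have hYω : Y * ω = -(ω * Yᵀ) := by simpa using h.adj 1
    have hYX : Y * X = -(X * Y) := by rw [hXY, neg_neg]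
    refine ⟨X, Y, X * Y * ω, h.sq, h.anticomm, ?_, ?_, ?_⟩
    · refine (IsUnit.mul ?_ ?_).mul h.isUnit
      · exact IsUnit.of_mul_eq_one (α⁻¹ • X) (by rw [Matrix.mul_smul, hX, smul_smul,
          inv_mul_cancel₀ hα, one_smul])
      · exact IsUnit.of_mul_eq_one (β⁻¹ • Y) (by rw [Matrix.mul_smul, hY, smul_smul,
          inv_mul_cancel₀ hβ, one_smul])
    · have hω : ωᵀ = -ω := by simpa using h.symm
      rw [transpose_mul, transpose_mul, hω, one_smul, Matrix.neg_mul, ← Matrix.mul_assoc,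
        ← Matrix.neg_mul, ← hYω, Matrix.mul_assoc, eq_comm.mp (neg_eq_iff_eq_neg.mpr hXω),
        Matrix.mul_neg, ← Matrix.mul_assoc, hYX, Matrix.neg_mul, neg_neg]
    · simp only [Fin.forall_fin_two, one_smul]
      constructor
      · change X * (X * Y * ω) = X * Y * ω * Xᵀ
        calc X * (X * Y * ω) = -(X * (Y * X) * ω) := by
              rw [hYX, Matrix.mul_neg, Matrix.neg_mul, neg_neg,
                Matrix.mul_assoc X (X * Y)]
          _ = X * Y * ω * Xᵀ := by
              rw [Matrix.mul_assoc _ ω, ← Matrix.mul_assoc X Y X, Matrix.mul_assoc _ X, hXω,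
                Matrix.mul_neg, neg_neg]
      · change Y * (X * Y * ω) = X * Y * ω * Yᵀ
        rw [Matrix.mul_assoc _ ω, eq_comm.mp (neg_eq_iff_eq_neg.mpr hYω), Matrix.mul_neg,
          ← Matrix.mul_assoc, ← Matrix.mul_assoc Y X, hYX]
        simp only [Matrix.mul_assoc, Matrix.neg_mul]
  · exact ⟨X, Y, ω, h⟩

end IsCliffordModel

/-- Every nondegenerate diagonal form in `2 * m` variables has a Clifford model of degree `2 ^ m`
with the given symmetry signs. -/
def CliffordModelsExist (F : Type*) [Field F] (m : ℕ) (δ ε : F) : Prop :=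
  ∀ d : Fin (2 * m) → F, (∀ i, d i ≠ 0) → ∃ (ι : Type) (_ : Fintype ι) (_ : DecidableEq ι)
    (x : Fin (2 * m) → Matrix ι ι F) (K : Matrix ι ι F), Fintype.card ι = 2 ^ m ∧
      IsCliffordModel δ ε d x K

namespace CliffordModelsExist

variable {F : Type*} [Field F]

theorem zero (δ : F) : CliffordModelsExist F 0 δ 1 := fun d _ ↦
  ⟨Unit, inferInstance, inferInstance, fun _ ↦ 1, 1, rfl,
    @IsCliffordModel.empty F (Fin 0) _ _ δ d⟩

theorem exists_cons_eq {m : ℕ} {d : Fin (m + 2) → F} (hd : ∀ i, d i ≠ 0) :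
    ∃ d' : Fin m → F, (∀ i, d' i ≠ 0) ∧
      d = Fin.cons (d 0) (Fin.cons (d 1) fun i ↦ -(d 0 * d 1) * d' i) := by
  have h : -(d 0 * d 1) ≠ 0 := neg_ne_zero.mpr (mul_ne_zero (hd 0) (hd 1))
  refine ⟨fun i ↦ (-(d 0 * d 1))⁻¹ * d i.succ.succ, fun i ↦ mul_ne_zero (inv_ne_zero h) (hd _), ?_⟩
  funext i
  refine Fin.cases rfl (fun i ↦ Fin.cases rfl (fun i ↦ ?_) i) i
  simp only [Fin.cons_succ]
  rw [mul_inv_cancel_left₀ h]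

theorem succ [Finite F] (h2 : (2 : F) ≠ 0) {m : ℕ} {γ ε : F} (hγ : γ = 1 ∨ γ = -1)
    (h : CliffordModelsExist F m (-γ) ε) : CliffordModelsExist F (m + 1) γ (γ * ε) := by
  intro d hd
  obtain ⟨d', hd', hdd⟩ := exists_cons_eq (m := 2 * m) hd
  obtain ⟨X, Y, K, hP⟩ := IsCliffordModel.exists_plane h2 hγ (hd 0) (hd 1)
  obtain ⟨ι, _, _, x, K', hc, hM⟩ := h d' hd'
  have := hP.tensor (by rcases hγ with rfl | rfl <;> simp) hM
  rw [← hdd] at this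
  exact ⟨Fin 2 × ι, inferInstance, inferInstance, _, _, by
    rw [Fintype.card_prod, hc, Fintype.card_fin, pow_succ, mul_comm], this⟩

theorem add_four [Finite F] (h2 : (2 : F) ≠ 0) {m : ℕ} {ε : F} (h : CliffordModelsExist F m 1 ε) :
    CliffordModelsExist F (m + 4) 1 ε := by
  have step : ∀ {m : ℕ} {ε : F}, CliffordModelsExist F m 1 ε →
      CliffordModelsExist F (m + 2) 1 (-ε) := by
    intro m ε h
    have h1 := succ h2 (γ := -1) (Or.inr rfl) (by rwa [neg_neg])
    have h3 := succ h2 (γ := 1) (Or.inl rfl) h1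
    simpa using h3
  simpa using step (step h)

theorem selfAdjoint_symmetric [Finite F] (h2 : (2 : F) ≠ 0) (m : ℕ) (hm : m % 4 = 0 ∨ m % 4 = 1) :
    CliffordModelsExist F m 1 1 := by
  induction m using Nat.strong_induction_on with
  | _ m ih =>
    by_cases h4 : 4 ≤ m
    · obtain ⟨k, rfl⟩ := Nat.exists_eq_add_of_le' h4
      exact add_four h2 (ih k (by omega) (by omega))
    · obtain rfl | rfl : m = 0 ∨ m = 1 := by omega
      · exact zero 1
      · simpa using succ h2 (γ := 1) (Or.inl rfl) (zero (-1))

end CliffordModelsExist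

/-- In the quaternionic residues a nondegenerate diagonal form has a Clifford model for which all
vectors lie in the symplectic Lie algebra of the standard form. -/
theorem exists_isCliffordModel_J {F : Type*} [Field F] [Finite F] (h2 : (2 : F) ≠ 0) {m : ℕ}
    (hm : m % 4 = 0 ∨ m % 4 = 1) {d : Fin (2 * m + 2) → F} (hd : ∀ i, d i ≠ 0) :
    ∃ x, IsCliffordModel (-1) (-1) d x (J (Fin (2 ^ m)) F) := by
  obtain ⟨d', hd', hdd⟩ := CliffordModelsExist.exists_cons_eq hd
  obtain ⟨X, Y, hP⟩ := IsCliffordModel.exists_neg_plane h2 (hd 0) (d 1)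
  obtain ⟨ι, _, _, x, K, hc, hM⟩ := CliffordModelsExist.selfAdjoint_symmetric h2 m hm d' hd'
  have e : Fin (2 ^ m) ≃ ι := Fintype.equivOfCardEq (by rw [hc, Fintype.card_fin])
  replace hM := hM.submatrix e
  set L := K.submatrix e e
  have hT := hP.tensor (by simp) (by rwa [neg_neg])
  rw [← hdd] at hT
  replace hT := hT.submatrix ((finTwoEquiv.prodCongr (Equiv.refl _)).trans
    (Equiv.boolProdEquivSum (Fin (2 ^ m)))).symm
  obtain ⟨u, hu⟩ := hM.isUnit
  have hsymm : Lᵀ = L := by simpa using hM.symm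
  have hform : (!![0, -1; 1, 0] ⊗ₖ L).submatrix ((finTwoEquiv.prodCongr (Equiv.refl _)).trans
      (Equiv.boolProdEquivSum (Fin (2 ^ m)))).symm ((finTwoEquiv.prodCongr (Equiv.refl _)).trans
      (Equiv.boolProdEquivSum (Fin (2 ^ m)))).symm = fromBlocks 0 (-L) L 0 := by
    ext i j
    rcases i with i | i <;> rcases j with j | j <;> simp [finTwoEquiv]
  have hinv : u⁻¹.valᵀ = u⁻¹.val := by
    have := congrArg transpose (Units.inv_mul u)
    rw [transpose_mul, hu, hsymm, ← hu, transpose_one] at this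
    exact (left_inv_eq_right_inv (Units.inv_mul u) this).symm
  rw [hform] at hT
  let P : Matrix (Fin (2 ^ m) ⊕ Fin (2 ^ m)) (Fin (2 ^ m) ⊕ Fin (2 ^ m)) F :=
    fromBlocks 1 0 0 u⁻¹.val
  let Q : Matrix (Fin (2 ^ m) ⊕ Fin (2 ^ m)) (Fin (2 ^ m) ⊕ Fin (2 ^ m)) F :=
    fromBlocks 1 0 0 u.val
  have hC := hT.conj (P := P) (Q := Q)
    (by simp only [P, Q, fromBlocks_multiply, Units.inv_mul]; simp)
    (by simp only [P, Q, fromBlocks_multiply, Units.mul_inv]; simp)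
  have hJ : P * fromBlocks 0 (-L) L 0 * Pᵀ = J (Fin (2 ^ m)) F := by
    simp only [P, fromBlocks_transpose, fromBlocks_multiply, hinv, ← hu]
    simp only [J, Matrix.zero_mul, Matrix.mul_zero, Matrix.one_mul, Matrix.mul_one, zero_add,
      add_zero, transpose_zero, transpose_one, Matrix.neg_mul, Units.mul_inv, Units.inv_mul]
  rw [hJ, mul_one] at hC
  exact ⟨_, hC⟩

/-- Every symmetric matrix is congruent to a diagonal one. -/
theorem Matrix.IsSymm.exists_eq_mul_diagonal_mul_transpose {F : Type*} [Field F] (h2 : (2 : F) ≠ 0)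
    {N : ℕ} {G : Matrix (Fin N) (Fin N) F} (hG : G.IsSymm) :
    ∃ (C : Matrix (Fin N) (Fin N) F) (d : Fin N → F), G = C * diagonal d * Cᵀ := by
  have : Invertible (2 : F) := invertibleOfNonzero h2
  have hB : LinearMap.IsSymm (Matrix.toBilin' G) := by
    constructor
    intro x y
    simp only [Matrix.toBilin'_apply', RingHom.id_apply]
    rw [dotProduct_mulVec, ← mulVec_transpose, hG.eq, dotProduct_comm]
  have hfin : Module.finrank F (Fin N → F) = N := by simp
  obtain ⟨v, hv⟩ := LinearMap.BilinForm.exists_orthogonal_basis (B := Matrix.toBilin' G) hB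
  let b := v.reindex (finCongr hfin)
  refine ⟨of fun i j ↦ b.repr (Pi.single i 1) j, fun j ↦ Matrix.toBilin' G (b j) (b j), ?_⟩
  ext i j
  rw [← Matrix.toBilin'_single G i j]
  conv_lhs => rw [← b.sum_repr (Pi.single i 1), ← b.sum_repr (Pi.single j 1)]
  simp only [map_sum, map_smul, LinearMap.sum_apply, LinearMap.smul_apply, smul_eq_mul,
    Finset.mul_sum]
  rw [Finset.sum_comm, mul_apply]
  simp only [mul_diagonal, transpose_apply, of_apply]
  refine Finset.sum_congr rfl fun k _ ↦ ?_
  rw [Finset.sum_eq_single k]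
  · ring
  · intro l _ hlk
    have : Matrix.toBilin' G (b k) (b l) = 0 := by
      simp only [b, Module.Basis.reindex_apply]
      exact hv (by simpa using hlk.symm)
    rw [this]; simp
  · simp

theorem isUnit_neg_two_smul_one_add_ones {F : Type*} [Field F] (h2 : (2 : F) ≠ 0)
    {N : ℕ} (hN : ((N + 2 : ℕ) : F) ≠ 0) :
    IsUnit (-((2 : F) • 1 + of fun _ _ ↦ 1) : Matrix (Fin N) (Fin N) F) := by
  push_cast at hN
  refine IsUnit.of_mul_eq_one ((2 : F)⁻¹ • (((N : F) + 2)⁻¹ • (of fun _ _ ↦ 1) - 1)) ?_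
  have h : (of fun _ _ ↦ 1 : Matrix (Fin N) (Fin N) F) * of (fun _ _ ↦ 1) =
      (N : F) • of (fun _ _ ↦ 1) := by
    ext i j; simp [mul_apply]
  generalize (of fun _ _ ↦ 1 : Matrix (Fin N) (Fin N) F) = E at h ⊢
  simp only [Matrix.mul_smul, Matrix.mul_sub, Matrix.mul_one, Matrix.neg_mul, Matrix.add_mul,
    Matrix.smul_mul, Matrix.one_mul, h]
  simp only [smul_sub, smul_add, smul_neg, smul_smul]
  match_scalars <;> field_simp
  ring

/-- The form with Gram matrix `-3` on and `-1` off the diagonal is nondegenerate and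
diagonalizes. -/
theorem exists_diagonalization_carmichael_form {F : Type*} [Field F] (h2 : (2 : F) ≠ 0)
    {N : ℕ} (hN : ((N + 2 : ℕ) : F) ≠ 0) :
    ∃ (C : Matrix (Fin N) (Fin N) F) (d : Fin N → F), (∀ i, d i ≠ 0) ∧
      ∀ i j, ∑ k, C i k * C j k * d k = if i = j then -3 else -1 := by
  have hU := isUnit_neg_two_smul_one_add_ones h2 hN
  have hS : (-((2 : F) • 1 + of fun _ _ ↦ 1) : Matrix (Fin N) (Fin N) F).IsSymm := by
    ext i j
    simp [one_apply, eq_comm]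
  obtain ⟨C, d, hC⟩ := hS.exists_eq_mul_diagonal_mul_transpose h2
  refine ⟨C, d, fun i hi ↦ ?_, fun i j ↦ ?_⟩
  · rw [isUnit_iff_isUnit_det, hC, det_mul, det_mul, det_diagonal,
      Finset.prod_eq_zero (Finset.mem_univ i) hi] at hU
    simp at hU
  · have := congrFun (congrFun hC i) j
    rw [mul_apply] at this
    simp only [mul_diagonal, transpose_apply] at this
    rw [Finset.sum_congr rfl fun k _ ↦ mul_right_comm _ _ _, ← this]
    split_ifs with h
    · subst h; simp; norm_num
    · simp [one_apply_ne h]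

theorem half_sub_one_mul {F M : Type*} [Field F] [Ring M] [Algebra F M] (h2 : (2 : F) ≠ 0)
    {s : M} (hs : s * s = (-3 : F) • (1 : M)) :
    (2⁻¹ : F) • (s - 1) * ((2⁻¹ : F) • (s - 1)) = (2⁻¹ : F) • (-s - 1) := by
  simp only [smul_mul_smul_comm, mul_sub, sub_mul, hs, mul_one, one_mul]
  match_scalars <;> field_simp <;> ring

theorem half_sub_one_mul_half_neg_sub_one {F M : Type*} [Field F] [Ring M] [Algebra F M]
    (h2 : (2 : F) ≠ 0) {s : M} (hs : s * s = (-3 : F) • (1 : M)) :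
    (2⁻¹ : F) • (s - 1) * ((2⁻¹ : F) • (-s - 1)) = 1 := by
  simp only [smul_mul_smul_comm, mul_sub, sub_mul, mul_neg, hs, mul_one, one_mul]
  match_scalars <;> field_simp <;> ring

theorem half_sub_one_mul_half_sub_one_sq {F M : Type*} [Field F] [Ring M] [Algebra F M]
    (h2 : (2 : F) ≠ 0) {s t : M} (hs : s * s = (-3 : F) • (1 : M))
    (ht : t * t = (-3 : F) • (1 : M)) (hst : s * t + t * s = (-2 : F) • (1 : M)) :
    ((2⁻¹ : F) • (s - 1) * ((2⁻¹ : F) • (t - 1))) ^ 2 = -1 := by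
  have hadd : (2⁻¹ : F) • (s - 1) * ((2⁻¹ : F) • (t - 1)) =
      -((2⁻¹ : F) • (-t - 1) * ((2⁻¹ : F) • (-s - 1))) := by
    rw [eq_neg_iff_add_eq_zero]
    simp only [smul_mul_smul_comm, ← smul_add]
    convert smul_zero _
    calc (s - 1) * (t - 1) + (-t - 1) * (-s - 1) = s * t + t * s + 2 • 1 := by noncomm_ring
      _ = 0 := by rw [hst]; match_scalars; ring
  rw [sq]
  nth_rw 2 [hadd]
  rw [mul_neg, mul_assoc, ← mul_assoc _ ((2⁻¹ : F) • (-t - 1)),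
    half_sub_one_mul_half_neg_sub_one h2 ht, one_mul, half_sub_one_mul_half_neg_sub_one h2 hs]

theorem half_sub_one_mem_symplecticGroup {F ι : Type*} [Field F] [Fintype ι] [DecidableEq ι]
    (h2 : (2 : F) ≠ 0) {s : Matrix (ι ⊕ ι) (ι ⊕ ι) F}
    (hs : s * s = (-3 : F) • (1 : Matrix (ι ⊕ ι) (ι ⊕ ι) F))
    (hsJ : s * J ι F = -(J ι F * sᵀ)) : (2⁻¹ : F) • (s - 1) ∈ symplecticGroup ι F := by
  rw [SymplecticGroup.mem_iff]
  have : J ι F * ((2⁻¹ : F) • (s - 1))ᵀ = (2⁻¹ : F) • (-s - 1) * J ι F := by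
    rw [transpose_smul, transpose_sub, transpose_one, Matrix.mul_smul, Matrix.smul_mul,
      Matrix.mul_sub, Matrix.mul_one, Matrix.sub_mul, Matrix.neg_mul, Matrix.one_mul, hsJ, neg_neg]
  rw [Matrix.mul_assoc, this, ← Matrix.mul_assoc, half_sub_one_mul_half_neg_sub_one h2 hs,
    Matrix.one_mul]

theorem IsCliffordModel.sum_smul_mul_add {F κ ι : Type*} [Field F] [Fintype ι] [DecidableEq ι]
    [Fintype κ] {δ ε : F} {d : κ → F} {x : κ → Matrix ι ι F} {K : Matrix ι ι F}
    (h : IsCliffordModel δ ε d x K) (a b : κ → F) :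
    (∑ k, a k • x k) * (∑ k, b k • x k) + (∑ k, b k • x k) * (∑ k, a k • x k) =
      (2 * ∑ k, a k * b k * d k) • (1 : Matrix ι ι F) := by
  classical
  simp only [Finset.sum_mul_sum, smul_mul_smul_comm]
  rw [Finset.sum_comm (s := Finset.univ) (f := fun i j ↦ (b i * a j) • (x i * x j)),
    ← Finset.sum_add_distrib, Finset.mul_sum, Finset.sum_smul]
  refine Finset.sum_congr rfl fun i _ ↦ ?_
  rw [← Finset.sum_add_distrib, Finset.sum_eq_single i]
  · rw [h.sq]
    module
  · intro j _ hj
    rw [h.anticomm i j hj.symm, mul_comm (b j)]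
    module
  · simp

/-- The symplectic group contains elements satisfying the Carmichael relations twisted by `-1`. -/
theorem exists_symplectic_carmichael_generators {F : Type*} [Field F] [Finite F] (h2 : (2 : F) ≠ 0)
    {m : ℕ} (hm : m % 4 = 0 ∨ m % 4 = 1) (hN : ((2 * m + 4 : ℕ) : F) ≠ 0) :
    ∃ T : Fin (2 * m + 2) → symplecticGroup (Fin (2 ^ m)) F, (∀ i, T i ^ 3 = 1) ∧
      ∀ i j, i ≠ j → (T i * T j) ^ 2 = ⟨-1, SymplecticGroup.neg_mem (one_mem _)⟩ := by
  obtain ⟨C, d, hd, hC⟩ := exists_diagonalization_carmichael_form h2 (N := 2 * m + 2) hN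
  obtain ⟨x, hx⟩ := exists_isCliffordModel_J h2 hm hd
  set s : Fin (2 * m + 2) → Matrix (Fin (2 ^ m) ⊕ Fin (2 ^ m)) (Fin (2 ^ m) ⊕ Fin (2 ^ m)) F :=
    fun i ↦ ∑ k, C i k • x k with hs
  have hsum : ∀ i j, s i * s j + s j * s i =
      (2 * if i = j then -3 else -1 : F) • (1 : Matrix _ _ F) := fun i j ↦ by
    rw [← hC]
    exact hx.sum_smul_mul_add (C i) (C j)
  have hsq : ∀ i, s i * s i = (-3 : F) • (1 : Matrix _ _ F) := fun i ↦ by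
    have := hsum i i
    rw [if_pos rfl, ← two_smul F, mul_smul] at this
    exact smul_right_injective _ h2 this
  have hadd : ∀ i j, i ≠ j → s i * s j + s j * s i = (-2 : F) • (1 : Matrix _ _ F) :=
    fun i j hij ↦ by
      rw [hsum, if_neg hij, mul_neg_one]
  have hsJ : ∀ i, s i * J (Fin (2 ^ m)) F = -(J (Fin (2 ^ m)) F * (s i)ᵀ) := fun i ↦ by
    simp only [hs, Finset.sum_mul, transpose_sum, Finset.mul_sum, transpose_smul, Matrix.smul_mul,
      Matrix.mul_smul, hx.adj, neg_smul, one_smul, smul_neg, Finset.sum_neg_distrib]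
  refine ⟨fun i ↦ ⟨_, half_sub_one_mem_symplecticGroup h2 (hsq i) (hsJ i)⟩, fun i ↦ ?_,
    fun i j hij ↦ ?_⟩
  · apply Subtype.ext
    change ((2⁻¹ : F) • (s i - 1)) ^ 3 = 1
    rw [pow_succ', sq, half_sub_one_mul h2 (hsq i), half_sub_one_mul_half_neg_sub_one h2 (hsq i)]
  · apply Subtype.ext
    change ((2⁻¹ : F) • (s i - 1) * ((2⁻¹ : F) • (s j - 1))) ^ 2 = -1
    exact half_sub_one_mul_half_sub_one_sq h2 (hsq i) (hsq j) (hadd i j hij)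

/-- The spin module gives a faithful symplectic representation of the double cover of the
alternating group on `2 * m + 4` letters when `m` is `0` or `1` modulo `4`. -/
theorem exists_hom_symplecticGroup_of_double_cover {F : Type*} [Field F] [Finite F]
    (h2 : (2 : F) ≠ 0) {m : ℕ} (hm : m % 4 = 0 ∨ m % 4 = 1) (hm0 : m ≠ 0)
    (hN : ((2 * m + 4 : ℕ) : F) ≠ 0) {H : Type*} [Group H] [Finite H] (hperf : commutator H = ⊤)
    (hcenter : Nat.card (Subgroup.center H) = 2)
    (e : (H ⧸ Subgroup.center H) ≃* alternatingGroup (Fin (2 * m + 4))) :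
    ∃ φ : H →* symplecticGroup (Fin (2 ^ m)) F, Function.Injective φ ∧
      ∀ z ∈ Subgroup.center H, z ≠ 1 →
        (φ z : Matrix (Fin (2 ^ m) ⊕ Fin (2 ^ m)) (Fin (2 ^ m) ⊕ Fin (2 ^ m)) F) = -1 := by
  have h01 : (0 : Fin (2 * m + 4)) ≠ 1 := by simp
  let π : H →* alternatingGroup (Fin (2 * m + 4)) :=
    e.toMonoidHom.comp (QuotientGroup.mk' (Subgroup.center H))
  have hπ : Function.Surjective π := e.surjective.comp (QuotientGroup.mk'_surjective _)
  have hker : π.ker = Subgroup.center H := by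
    ext h
    change e (h : H ⧸ Subgroup.center H) = 1 ↔ _
    rw [EmbeddingLike.map_eq_one_iff, QuotientGroup.eq_one_iff]
  obtain ⟨z', hz', hz⟩ := (Nat.card_eq_two_iff' (1 : Subgroup.center H)).mp hcenter
  obtain ⟨z, hzmem⟩ := z'
  have hz1 : z ≠ 1 := fun h ↦ hz' (Subtype.ext h)
  have hcen : ∀ c ∈ Subgroup.center H, c = 1 ∨ c = z := fun c hc ↦ by
    by_contra! h
    exact h.2 (congrArg Subtype.val (hz ⟨c, hc⟩ fun h1 ↦ h.1 (congrArg Subtype.val h1)))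
  have hz2 : z * z = 1 := (hcen _ (mul_mem hzmem hzmem)).resolve_right fun h ↦
    hz1 (by simpa using h)
  have hcard := card_eq_factorial_of_double_cover π hπ (by rw [hker, hcenter])
  obtain ⟨X, hX3, hXX, hX⟩ := exists_carmichael_lift h01 (by rw [Fintype.card_fin]; omega) hperf π
    hπ hker hzmem hz1 hz2 hcen hcard
  obtain ⟨T, hT3, hTT⟩ := exists_symplectic_carmichael_generators h2 hm hN
  let f : {i : Fin (2 * m + 4) // i ≠ 0 ∧ i ≠ 1} ≃ Fin (2 * m + 2) := Fintype.equivOfCardEq (by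
    have := card_compl_pair_add_two h01
    rw [Fintype.card_fin] at this ⊢
    omega)
  obtain ⟨φ, hφ⟩ := exists_hom_of_carmichael_relations h01
    (fun g ↦ (Subgroup.mem_center_iff.mp hzmem g).symm) hz2 hcard X hX3 hXX hX
    (w := (⟨-1, SymplecticGroup.neg_mem (one_mem _)⟩ : symplecticGroup (Fin (2 ^ m)) F))
    (fun g ↦ Subtype.ext (by simp)) (Subtype.ext (by simp)) (fun i ↦ T (f i)) (fun i ↦ hT3 _)
    fun i j hij ↦ hTT _ _ (f.injective.ne hij)
  have hφ1 : φ z ≠ 1 := fun h ↦ by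
    have h1 := congrArg (fun A ↦ A.val (Sum.inl 0) (Sum.inl 0)) (hφ.symm.trans h)
    simp only [Matrix.neg_apply, OneMemClass.coe_one, one_apply_eq] at h1
    exact h2 (by linear_combination -h1)
  have : IsSimpleGroup (alternatingGroup (Fin (2 * m + 4))) :=
    alternatingGroup.isSimpleGroup (by rw [Nat.card_eq_fintype_card, Fintype.card_fin]; omega)
  refine ⟨φ, injective_of_perfect_double_cover hperf π hπ hker hcen φ hφ1, fun y hy hy1 ↦ ?_⟩
  rw [(hcen y hy).resolve_left hy1, hφ]

end CliffordModels

theorem stmt5 (p k q n : ℕ) (hp : p.Prime) (hp2 : 2 < p) (hk : 0 < k) (hq : q = p ^ k)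
    (hn : n % 8 = 4 ∨ n % 8 = 6) (hpn : ¬ p ∣ n)
    (F : Type) [Field F] [Fintype F] (hF : Fintype.card F = q)
    (H : Type) [Group H] [Fintype H]
    (hperf : commutator H = ⊤)
    (hcenter : Nat.card (Subgroup.center H) = 2)
    (hquot : Nonempty ((H ⧸ Subgroup.center H) ≃* alternatingGroup (Fin n))) :
    ∃ φ : H →* Matrix.symplecticGroup (Fin (2 ^ ((n - 2) / 2 - 1))) F,
      Function.Injective φ ∧
      ∀ z : H, z ∈ Subgroup.center H → z ≠ 1 →
        ((φ z : Matrix (Fin (2 ^ ((n - 2) / 2 - 1)) ⊕ Fin (2 ^ ((n - 2) / 2 - 1)))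
          (Fin (2 ^ ((n - 2) / 2 - 1)) ⊕ Fin (2 ^ ((n - 2) / 2 - 1))) F) = -1) := by
  obtain ⟨e⟩ := hquot
  have : Fact p.Prime := ⟨hp⟩
  have hchar : CharP F p := charP_of_card_eq_prime_pow (hF.trans hq)
  have h2 : (2 : F) ≠ 0 := by
    have := (CharP.cast_eq_zero_iff F p 2).not.mpr fun h ↦ hp2.not_ge (Nat.le_of_dvd two_pos h)
    exact_mod_cast this
  obtain ⟨m, rfl⟩ : ∃ m, n = 2 * m + 4 := ⟨(n - 4) / 2, by omega⟩
  have hm : (2 * m + 4 - 2) / 2 - 1 = m := by omega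
  rw [hm]
  rcases eq_or_ne m 0 with rfl | hm0
  · exact absurd hperf (not_perfect_of_surjective_alternatingGroup_four (by simp)
      (e.toMonoidHom.comp (QuotientGroup.mk' (Subgroup.center H)))
      (e.surjective.comp (QuotientGroup.mk'_surjective _)))
  · exact exists_hom_symplecticGroup_of_double_cover h2 (by omega) hm0
      ((CharP.cast_eq_zero_iff F p _).not.mpr hpn) hperf hcenter e
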